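/- Reverse Poincaré inequality for biharmonic functions on ℝⁿ: there exists R₀ > 0 such that for every smooth u : ℝⁿ → ℝ with Δ²u = 0, every r > R₀, and every α > 1, one has r² ∫_{B_r(0)} |Δu|² dx ≤ C ∫_{B_{αr}(0)} u² dx, where C depends only on n and α. -/

import Mathlib

open MeasureTheory

noncomputable def lap {n : ℕ} (u : EuclideanSpace ℝ (Fin n) → ℝ)
    (x : EuclideanSpace ℝ (Fin n)) : ℝ :=
  ∑ i : Fin n, fderiv ℝ (fun y => fderiv ℝ u y (EuclideanSpace.single i 1)) x
    (EuclideanSpace.single i 1)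

open scoped ContDiff

/-- The partial derivative of `f` in the `i`-th coordinate direction. -/
noncomputable def coordDeriv {n : ℕ} (i : Fin n) (f : EuclideanSpace ℝ (Fin n) → ℝ)
    (x : EuclideanSpace ℝ (Fin n)) : ℝ :=
  fderiv ℝ f x (EuclideanSpace.single i 1)

section Calculus

variable {n : ℕ} {f g : EuclideanSpace ℝ (Fin n) → ℝ}

lemma lap_eq_sum_coordDeriv (f : EuclideanSpace ℝ (Fin n) → ℝ) (x : EuclideanSpace ℝ (Fin n)) :
    lap f x = ∑ i, coordDeriv i (coordDeriv i f) x := rfl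

lemma ContDiff.coordDeriv (hf : ContDiff ℝ ∞ f) (i : Fin n) : ContDiff ℝ ∞ (coordDeriv i f) :=
  (hf.fderiv_right (m := ∞) (by simp)).clm_apply contDiff_const

lemma ContDiff.lap (hf : ContDiff ℝ ∞ f) : ContDiff ℝ ∞ (lap f) :=
  ContDiff.sum fun i _ => (hf.coordDeriv i).coordDeriv i

lemma HasCompactSupport.coordDeriv (hf : HasCompactSupport f) (i : Fin n) :
    HasCompactSupport (coordDeriv i f) :=
  hf.fderiv_apply ℝ _

lemma HasCompactSupport.lap (hf : HasCompactSupport f) : HasCompactSupport (lap f) := by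
  refine hf.mono' fun x hx => ?_
  obtain ⟨i, -, hi⟩ := Finset.exists_ne_zero_of_sum_ne_zero hx
  exact tsupport_fderiv_apply_subset ℝ _ (tsupport_fderiv_apply_subset ℝ _ (subset_tsupport _ hi))

lemma coordDeriv_mul (hf : ContDiff ℝ ∞ f) (hg : ContDiff ℝ ∞ g) (i : Fin n) :
    coordDeriv i (fun x => f x * g x) = fun x => f x * coordDeriv i g x + coordDeriv i f x * g x := by
  ext x
  have hf' := (hf.differentiable (by simp)) x
  have hg' := (hg.differentiable (by simp)) x
  simp [coordDeriv, fderiv_fun_mul hf' hg']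
  ring

lemma coordDeriv_add (hf : ContDiff ℝ ∞ f) (hg : ContDiff ℝ ∞ g) (i : Fin n) :
    coordDeriv i (fun x => f x + g x) = fun x => coordDeriv i f x + coordDeriv i g x := by
  ext x
  have hf' := (hf.differentiable (by simp)) x
  have hg' := (hg.differentiable (by simp)) x
  simp [coordDeriv, fderiv_fun_add hf' hg']

lemma coordDeriv_const_mul (hf : ContDiff ℝ ∞ f) (c : ℝ) (i : Fin n) :
    coordDeriv i (fun x => c * f x) = fun x => c * coordDeriv i f x := by
  ext x
  have hf' := (hf.differentiable (by simp)) x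
  simp [coordDeriv, fderiv_const_mul hf']

lemma coordDeriv_pow_succ (hf : ContDiff ℝ ∞ f) (k : ℕ) (i : Fin n) :
    coordDeriv i (fun x => f x ^ (k + 1)) = fun x => (k + 1) * (f x ^ k * coordDeriv i f x) := by
  ext x
  have hf' := (hf.differentiable (by simp)) x
  simp [coordDeriv, fderiv_fun_pow (k + 1) hf']
  ring

lemma coordDeriv_coordDeriv_pow (hf : ContDiff ℝ ∞ f) (k : ℕ) (i : Fin n)
    (x : EuclideanSpace ℝ (Fin n)) :
    coordDeriv i (coordDeriv i (fun x => f x ^ (k + 2))) x =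
      (k + 2) * f x ^ k *
        ((k + 1) * coordDeriv i f x ^ 2 + f x * coordDeriv i (coordDeriv i f) x) := by
  rw [coordDeriv_pow_succ hf (k + 1), coordDeriv_const_mul ((hf.pow _).mul (hf.coordDeriv i)),
    coordDeriv_mul (hf.pow _) (hf.coordDeriv i), coordDeriv_pow_succ hf k]
  push_cast
  ring

lemma lap_mul (hf : ContDiff ℝ ∞ f) (hg : ContDiff ℝ ∞ g) (x : EuclideanSpace ℝ (Fin n)) :
    lap (fun x => f x * g x) x =
      f x * lap g x + ∑ i, 2 * coordDeriv i f x * coordDeriv i g x + lap f x * g x := by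
  simp only [lap_eq_sum_coordDeriv, Finset.mul_sum, Finset.sum_mul, ← Finset.sum_add_distrib]
  refine Finset.sum_congr rfl fun i _ => ?_
  rw [coordDeriv_mul hf hg, coordDeriv_add (hf.mul (hg.coordDeriv i)) ((hf.coordDeriv i).mul hg),
    coordDeriv_mul hf (hg.coordDeriv i), coordDeriv_mul (hf.coordDeriv i) hg]
  ring

lemma lap_sq_of_lap_eq_zero (hf : ContDiff ℝ ∞ f) {x : EuclideanSpace ℝ (Fin n)}
    (hx : lap f x = 0) :
    lap (fun x => f x ^ 2) x = 2 * ∑ i, coordDeriv i f x ^ 2 := by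
  have := lap_mul hf hf x
  simp only [hx, ← sq] at this
  rw [this, Finset.mul_sum, mul_zero, zero_mul, zero_add, add_zero]
  exact Finset.sum_congr rfl fun i _ => by ring

lemma lap_comp_smul (hf : ContDiff ℝ ∞ f) (r : ℝ) (x : EuclideanSpace ℝ (Fin n)) :
    lap (fun x => f (r • x)) x = r ^ 2 * lap f (r • x) := by
  have key (h : EuclideanSpace ℝ (Fin n) → ℝ) (i : Fin n) :
      coordDeriv i (fun x => h (r • x)) = fun x => r * coordDeriv i h (r • x) := by
    ext y
    simp [coordDeriv, fderiv_comp_smul]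
  have hs : ContDiff ℝ ∞ fun x : EuclideanSpace ℝ (Fin n) => r • x := contDiff_id.const_smul r
  rw [lap_eq_sum_coordDeriv, lap_eq_sum_coordDeriv, Finset.mul_sum]
  refine Finset.sum_congr rfl fun i _ => ?_
  rw [key, coordDeriv_const_mul (f := fun x => coordDeriv i f (r • x)) ((hf.coordDeriv i).comp hs),
    key]
  ring

lemma integral_mul_coordDeriv (hf : ContDiff ℝ ∞ f) (hg : ContDiff ℝ ∞ g)
    (hfc : HasCompactSupport f) (i : Fin n) :
    ∫ x, f x * coordDeriv i g x = - ∫ x, coordDeriv i f x * g x := by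
  refine integral_mul_fderiv_eq_neg_fderiv_mul_of_integrable ?_ ?_ ?_
    (fun x _ => hf.differentiable (by simp) x) (fun x _ => hg.differentiable (by simp) x)
  · exact ((hf.coordDeriv i).continuous.mul hg.continuous).integrable_of_hasCompactSupport
      (hfc.coordDeriv i).mul_right
  · exact (hf.continuous.mul (hg.coordDeriv i).continuous).integrable_of_hasCompactSupport
      hfc.mul_right
  · exact (hf.continuous.mul hg.continuous).integrable_of_hasCompactSupport hfc.mul_right

/-- Green's second identity for a compactly supported first function. -/
lemma integral_mul_lap (hf : ContDiff ℝ ∞ f) (hg : ContDiff ℝ ∞ g) (hfc : HasCompactSupport f) :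
    ∫ x, f x * lap g x = ∫ x, lap f x * g x := by
  simp only [lap_eq_sum_coordDeriv, Finset.mul_sum, Finset.sum_mul]
  rw [integral_finsetSum, integral_finsetSum]
  · refine Finset.sum_congr rfl fun i _ => ?_
    rw [integral_mul_coordDeriv hf (hg.coordDeriv i) hfc,
      integral_mul_coordDeriv (hf.coordDeriv i) hg (hfc.coordDeriv i), neg_neg]
  · intro i _
    exact (((hf.coordDeriv i).coordDeriv i).continuous.mul
      hg.continuous).integrable_of_hasCompactSupport ((hfc.coordDeriv i).coordDeriv i).mul_right
  · intro i _
    exact (hf.continuous.mul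
      ((hg.coordDeriv i).coordDeriv i).continuous).integrable_of_hasCompactSupport hfc.mul_right

lemma exists_forall_abs_coordDeriv_le (hf : ContDiff ℝ ∞ f) (hfc : HasCompactSupport f) :
    ∃ K : ℝ, 0 ≤ K ∧ ∀ i x, |coordDeriv i f x| ≤ K := by
  choose C hC using fun i =>
    (hfc.coordDeriv i).exists_bound_of_continuous (hf.coordDeriv i).continuous
  refine ⟨∑ i, |C i|, by positivity, fun i x => (hC i x).trans ((le_abs_self _).trans ?_)⟩
  exact Finset.single_le_sum (f := fun i => |C i|) (fun j _ => abs_nonneg _) (Finset.mem_univ i)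

lemma abs_lap_pow_le (hf : ContDiff ℝ ∞ f) {K L : ℝ} (hK : ∀ i x, |coordDeriv i f x| ≤ K)
    (hL : ∀ i x, |coordDeriv i (coordDeriv i f) x| ≤ L) (k : ℕ) {x : EuclideanSpace ℝ (Fin n)}
    (h0 : 0 ≤ f x) (h1 : f x ≤ 1) :
    |lap (fun x => f x ^ (k + 2)) x| ≤ n * ((k + 2) * ((k + 1) * K ^ 2 + L)) * f x ^ k := by
  rw [lap_eq_sum_coordDeriv]
  refine (Finset.abs_sum_le_sum_abs _ _).trans ?_
  have (i : Fin n) : |coordDeriv i (coordDeriv i (fun x => f x ^ (k + 2))) x| ≤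
      ((k + 2) * ((k + 1) * K ^ 2 + L)) * f x ^ k := by
    rw [coordDeriv_coordDeriv_pow hf, abs_mul, abs_of_nonneg (by positivity : 0 ≤ (k + 2) * f x ^ k)]
    have h2 : |(k + 1) * coordDeriv i f x ^ 2 + f x * coordDeriv i (coordDeriv i f) x| ≤
        (k + 1) * K ^ 2 + L := by
      refine (abs_add_le _ _).trans (add_le_add ?_ ?_)
      · rw [abs_of_nonneg (by positivity)]
        gcongr (k + 1) * ?_
        rw [← sq_abs]
        gcongr
        exact hK i x
      · rw [abs_mul, abs_of_nonneg h0]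
        calc f x * _ ≤ 1 * |coordDeriv i (coordDeriv i f) x| := by gcongr
          _ ≤ L := by rw [one_mul]; exact hL i x
    calc _ ≤ (k + 2) * f x ^ k * ((k + 1) * K ^ 2 + L) := by gcongr
      _ = _ := by ring
  refine (Finset.sum_le_sum fun i _ => this i).trans ?_
  simp [mul_assoc]

end Calculus

section Estimate

variable {n : ℕ} {φ u v : EuclideanSpace ℝ (Fin n) → ℝ}

lemma exists_bound_derivatives_cutoff_pow (hφ : ContDiff ℝ ∞ φ) (hc : HasCompactSupport φ)
    (h0 : ∀ x, 0 ≤ φ x) (h1 : ∀ x, φ x ≤ 1) :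
    ∃ M : ℝ, 0 < M ∧ (∀ i x, |coordDeriv i (fun x => φ x ^ 4) x| ≤ M * φ x ^ 3) ∧
      (∀ x, |lap (fun x => φ x ^ 4) x| ≤ M * φ x ^ 2) ∧
      ∀ x, |lap (fun x => φ x ^ 6) x| ≤ M * φ x ^ 4 := by
  obtain ⟨K, hK0, hK⟩ := exists_forall_abs_coordDeriv_le hφ hc
  choose L hL0 hL using fun i =>
    exists_forall_abs_coordDeriv_le (hφ.coordDeriv i) (hc.coordDeriv i)
  have hL' (i x) : |coordDeriv i (coordDeriv i φ) x| ≤ ∑ j, L j :=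
    (hL i i x).trans (Finset.single_le_sum (fun j _ => hL0 j) (Finset.mem_univ i))
  set S := ∑ j, L j
  have hS : 0 ≤ S := Finset.sum_nonneg fun j _ => hL0 j
  set A : ℝ := n * ((2 + 2) * ((2 + 1) * K ^ 2 + S))
  set B : ℝ := n * ((4 + 2) * ((4 + 1) * K ^ 2 + S))
  have hA : 0 ≤ A := by positivity
  have hB : 0 ≤ B := by positivity
  refine ⟨1 + 4 * K + A + B, by positivity, fun i x => ?_, fun x => ?_, fun x => ?_⟩
  · have h3 : 0 ≤ φ x ^ 3 := pow_nonneg (h0 x) 3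
    rw [coordDeriv_pow_succ hφ 3, abs_mul, abs_mul, abs_of_nonneg h3]
    calc |((3 : ℕ) : ℝ) + 1| * (φ x ^ 3 * |coordDeriv i φ x|)
        = 4 * |coordDeriv i φ x| * φ x ^ 3 := by
          norm_num
          ring
      _ ≤ (4 * K) * φ x ^ 3 := by gcongr; exact hK i x
      _ ≤ _ := by gcongr; linarith
  · refine (abs_lap_pow_le hφ hK hL' 2 (h0 x) (h1 x)).trans ?_
    have := h0 x
    gcongr
    push_cast
    linarith
  · refine (abs_lap_pow_le hφ hK hL' 4 (h0 x) (h1 x)).trans ?_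
    have := h0 x
    gcongr
    push_cast
    linarith

/-- Caccioppoli's inequality for a harmonic function `v`. -/
lemma integral_pow_six_mul_sum_sq_coordDeriv_le (hφ : ContDiff ℝ ∞ φ) (hc : HasCompactSupport φ)
    (hv : ContDiff ℝ ∞ v) (hv0 : ∀ x, lap v x = 0) {M : ℝ}
    (hM : ∀ x, |lap (fun x => φ x ^ 6) x| ≤ M * φ x ^ 4) :
    2 * ∫ x, φ x ^ 6 * ∑ i, coordDeriv i v x ^ 2 ≤ M * ∫ x, φ x ^ 4 * v x ^ 2 := by
  have hc6 : HasCompactSupport fun x => φ x ^ 6 := hc.comp_left (g := (· ^ 6)) (by simp)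
  have hc4 : HasCompactSupport fun x => φ x ^ 4 := hc.comp_left (g := (· ^ 4)) (by simp)
  have green := integral_mul_lap (hφ.pow 6) (hv.pow 2) hc6
  simp only [lap_sq_of_lap_eq_zero hv (hv0 _), mul_left_comm _ (2 : ℝ), integral_const_mul] at green
  rw [green, ← integral_const_mul]
  refine integral_mono ?_ ?_ fun x => ?_
  · exact ((hφ.pow 6).lap.continuous.mul (hv.pow 2).continuous).integrable_of_hasCompactSupport
      hc6.lap.mul_right
  · exact (((hφ.pow 4).continuous.mul (hv.pow 2).continuous).integrable_of_hasCompactSupport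
      hc4.mul_right).const_mul M
  · change _ * v x ^ 2 ≤ M * (φ x ^ 4 * v x ^ 2)
    rw [← mul_assoc]
    gcongr
    exact (le_abs_self _).trans (hM x)

lemma lap_mul_mul_le (hφ : ContDiff ℝ ∞ φ) (hv : ContDiff ℝ ∞ v) (hv0 : ∀ x, lap v x = 0)
    {M : ℝ} (hM0 : 0 < M) {x : EuclideanSpace ℝ (Fin n)}
    (hM1 : ∀ i, |coordDeriv i (fun x => φ x ^ 4) x| ≤ M * φ x ^ 3)
    (hM2 : |lap (fun x => φ x ^ 4) x| ≤ M * φ x ^ 2) (t : ℝ) :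
    lap (fun x => φ x ^ 4 * v x) x * t ≤
      1 / (2 * M) * (φ x ^ 6 * ∑ i, coordDeriv i v x ^ 2) + 1 / 4 * (φ x ^ 4 * v x ^ 2) +
        (n * (2 * M ^ 3) + M ^ 2) * t ^ 2 := by
  have hsum : (∑ i, 2 * coordDeriv i (fun x => φ x ^ 4) x * coordDeriv i v x) * t ≤
      1 / (2 * M) * (φ x ^ 6 * ∑ i, coordDeriv i v x ^ 2) + n * (2 * M ^ 3) * t ^ 2 := by
    have key (i : Fin n) : 2 * coordDeriv i (fun x => φ x ^ 4) x * coordDeriv i v x * t ≤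
        1 / (2 * M) * (φ x ^ 6 * coordDeriv i v x ^ 2) + 2 * M ^ 3 * t ^ 2 := by
      set p := coordDeriv i (fun x => φ x ^ 4) x
      set q := coordDeriv i v x
      have h1 : p * q * t ≤ M * φ x ^ 3 * |q| * |t| := by
        refine (le_abs_self _).trans ?_
        rw [abs_mul, abs_mul]
        gcongr
        exact hM1 i
      have h2 : 1 / (2 * M) * (φ x ^ 6 * q ^ 2) + 2 * M ^ 3 * t ^ 2 - 2 * (M * φ x ^ 3 * |q| * |t|)
          = 1 / (2 * M) * (φ x ^ 3 * |q| - 2 * M ^ 2 * |t|) ^ 2 := by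
        rw [← sq_abs q, ← sq_abs t]
        field_simp
        ring
      have h3 : 0 ≤ 1 / (2 * M) * (φ x ^ 3 * |q| - 2 * M ^ 2 * |t|) ^ 2 := by positivity
      linarith
    rw [Finset.sum_mul]
    refine (Finset.sum_le_sum fun i _ => key i).trans (le_of_eq ?_)
    simp [Finset.sum_add_distrib, Finset.mul_sum]
    ring
  have hlap : lap (fun x => φ x ^ 4) x * v x * t ≤ 1 / 4 * (φ x ^ 4 * v x ^ 2) + M ^ 2 * t ^ 2 := by
    have h1 : lap (fun x => φ x ^ 4) x * v x * t ≤ M * φ x ^ 2 * |v x| * |t| := by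
      refine (le_abs_self _).trans ?_
      rw [abs_mul, abs_mul]
      gcongr
    rw [← sq_abs (v x), ← sq_abs t]
    nlinarith [sq_nonneg (1 / 2 * (φ x ^ 2 * |v x|) - M * |t|)]
  rw [lap_mul (hφ.pow 4) hv, hv0]
  linarith

lemma integral_pow_four_mul_lap_sq_le (hφ : ContDiff ℝ ∞ φ) {s : Set (EuclideanSpace ℝ (Fin n))}
    (hs : MeasurableSet s) (hsupp : Function.support φ = s) (hc : HasCompactSupport φ)
    (hu : ContDiff ℝ ∞ u) (hu0 : ∀ x, lap (lap u) x = 0) {M : ℝ} (hM0 : 0 < M)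
    (hM1 : ∀ i x, |coordDeriv i (fun x => φ x ^ 4) x| ≤ M * φ x ^ 3)
    (hM2 : ∀ x, |lap (fun x => φ x ^ 4) x| ≤ M * φ x ^ 2)
    (hM3 : ∀ x, |lap (fun x => φ x ^ 6) x| ≤ M * φ x ^ 4) :
    ∫ x, φ x ^ 4 * lap u x ^ 2 ≤ 2 * (n * (2 * M ^ 3) + M ^ 2) * ∫ x in s, u x ^ 2 := by
  have hv := hu.lap
  have hc4 : HasCompactSupport fun x => φ x ^ 4 := hc.comp_left (g := (· ^ 4)) (by simp)
  have hc6 : HasCompactSupport fun x => φ x ^ 6 := hc.comp_left (g := (· ^ 6)) (by simp)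
  have hcacc := integral_pow_six_mul_sum_sq_coordDeriv_le hφ hc hv hu0 hM3
  have green := integral_mul_lap ((hφ.pow 4).mul hv) hu hc4.mul_right
  have hI1 : Integrable fun x => φ x ^ 6 * ∑ i, coordDeriv i (lap u) x ^ 2 :=
    ((hφ.pow 6).mul (ContDiff.sum fun i _ => (hv.coordDeriv i).pow 2)).continuous
      |>.integrable_of_hasCompactSupport hc6.mul_right
  have hI2 : Integrable fun x => φ x ^ 4 * lap u x ^ 2 :=
    ((hφ.pow 4).mul (hv.pow 2)).continuous.integrable_of_hasCompactSupport hc4.mul_right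
  have hI3 : Integrable (s.indicator fun x => u x ^ 2) := by
    rw [integrable_indicator_iff hs]
    refine ((hu.pow 2).continuous.continuousOn.integrableOn_compact
      (hc : IsCompact (tsupport φ))).mono_set ?_
    rw [← hsupp]
    exact subset_tsupport φ
  have hmain : ∫ x, φ x ^ 4 * lap u x ^ 2 ≤
      ∫ x, (1 / (2 * M) * (φ x ^ 6 * ∑ i, coordDeriv i (lap u) x ^ 2) +
        1 / 4 * (φ x ^ 4 * lap u x ^ 2) +
        (n * (2 * M ^ 3) + M ^ 2) * s.indicator (fun x => u x ^ 2) x) := by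
    have h : ∫ x, φ x ^ 4 * lap u x ^ 2 = ∫ x, lap (fun x => φ x ^ 4 * lap u x) x * u x := by
      rw [← green]
      simp only [sq, mul_assoc]
    rw [h]
    refine integral_mono ?_ (((hI1.const_mul _).add (hI2.const_mul _)).add (hI3.const_mul _))
      fun x => ?_
    · exact (((hφ.pow 4).mul hv).lap.continuous.mul hu.continuous).integrable_of_hasCompactSupport
        (hc4.mul_right.lap).mul_right
    · by_cases hx : x ∈ s
      · simpa [hx] using lap_mul_mul_le hφ hv hu0 hM0 (fun i => hM1 i x) (hM2 x) (u x)
      · have hφx : φ x = 0 := by rwa [← hsupp, Function.notMem_support] at hx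
        have h0 : lap (fun x => φ x ^ 4 * lap u x) x = 0 := by
          have h1 (i : Fin n) : coordDeriv i (fun x => φ x ^ 4) x = 0 := by
            simpa [hφx] using hM1 i x
          have h2 : lap (fun x => φ x ^ 4) x = 0 := by simpa [hφx] using hM2 x
          simp [lap_mul (hφ.pow 4) hv, h1, h2, hφx]
        simp [h0, hφx, hx]
  have hI12 : Integrable fun x => 1 / (2 * M) * (φ x ^ 6 * ∑ i, coordDeriv i (lap u) x ^ 2) +
      1 / 4 * (φ x ^ 4 * lap u x ^ 2) := (hI1.const_mul _).add (hI2.const_mul _)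
  rw [integral_add hI12 (hI3.const_mul _), integral_add (hI1.const_mul _) (hI2.const_mul _),
    integral_const_mul, integral_const_mul, integral_const_mul, integral_indicator hs] at hmain
  have hfin : 1 / (2 * M) * ∫ x, φ x ^ 6 * ∑ i, coordDeriv i (lap u) x ^ 2 ≤
      1 / 4 * ∫ x, φ x ^ 4 * lap u x ^ 2 := by
    rw [div_mul_eq_mul_div, div_le_iff₀ (by positivity)]
    linarith
  linarith

end Estimate

lemma exists_integral_unit_ball_lap_sq_le (n : ℕ) {α : ℝ} (hα : 1 < α) :
    ∃ C : ℝ, 0 < C ∧ ∀ u : EuclideanSpace ℝ (Fin n) → ℝ, ContDiff ℝ ∞ u →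
      (∀ x, lap (lap u) x = 0) →
        ∫ x in Metric.ball (0 : EuclideanSpace ℝ (Fin n)) 1, lap u x ^ 2 ≤
          C * ∫ x in Metric.ball (0 : EuclideanSpace ℝ (Fin n)) α, u x ^ 2 := by
  let φ : ContDiffBump (0 : EuclideanSpace ℝ (Fin n)) := ⟨1, α, one_pos, hα⟩
  have hφ : ContDiff ℝ ∞ φ := φ.contDiff
  obtain ⟨M, hM0, hM1, hM2, hM3⟩ := exists_bound_derivatives_cutoff_pow hφ φ.hasCompactSupport
    (fun _ => φ.nonneg) (fun _ => φ.le_one)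
  refine ⟨2 * (n * (2 * M ^ 3) + M ^ 2), by positivity, fun u hu hu0 => ?_⟩
  refine le_trans ?_ (integral_pow_four_mul_lap_sq_le hφ measurableSet_ball φ.support_eq
    φ.hasCompactSupport hu hu0 hM0 hM1 hM2 hM3)
  have hc4 : HasCompactSupport fun x => φ x ^ 4 :=
    φ.hasCompactSupport.comp_left (g := (· ^ 4)) (by simp)
  have hI : Integrable fun x => φ x ^ 4 * lap u x ^ 2 :=
    ((hφ.pow 4).mul (hu.lap.pow 2)).continuous.integrable_of_hasCompactSupport hc4.mul_right
  calc ∫ x in Metric.ball (0 : EuclideanSpace ℝ (Fin n)) 1, lap u x ^ 2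
      = ∫ x in Metric.ball (0 : EuclideanSpace ℝ (Fin n)) 1, φ x ^ 4 * lap u x ^ 2 := by
        refine setIntegral_congr_fun measurableSet_ball fun x hx => ?_
        simp [φ.one_of_mem_closedBall (Metric.ball_subset_closedBall hx)]
    _ ≤ _ := setIntegral_le_integral hI (ae_of_all _ fun x =>
        mul_nonneg (pow_nonneg φ.nonneg 4) (sq_nonneg _))

/-- Reverse Poincaré inequality for biharmonic functions on ℝⁿ. -/
theorem reverse_poincare_biharmonic (n : ℕ) :
    ∃ R₀ : ℝ, 0 < R₀ ∧ ∀ α : ℝ, 1 < α → ∃ C : ℝ, 0 < C ∧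
      ∀ u : EuclideanSpace ℝ (Fin n) → ℝ, ContDiff ℝ (⊤ : ℕ∞) u →
        (∀ x, lap (lap u) x = 0) → ∀ r : ℝ, R₀ < r →
          r ^ 2 * ∫ x in Metric.ball (0 : EuclideanSpace ℝ (Fin n)) r, (lap u x) ^ 2
            ≤ C * ∫ x in Metric.ball (0 : EuclideanSpace ℝ (Fin n)) (α * r), (u x) ^ 2 := by
  refine ⟨1, one_pos, fun α hα => ?_⟩
  obtain ⟨C, hC0, hC⟩ := exists_integral_unit_ball_lap_sq_le n hα
  refine ⟨C, hC0, fun u hu hu0 r hr => ?_⟩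
  have hr0 : 0 < r := by linarith
  have hlap : lap (fun x => u (r • x)) = fun x => r ^ 2 * lap u (r • x) :=
    funext (lap_comp_smul hu r)
  have hs : ContDiff ℝ ∞ fun x : EuclideanSpace ℝ (Fin n) => r • x := contDiff_id.const_smul r
  have h := hC (fun x => u (r • x)) (hu.comp hs) fun x => by
    have hv : ContDiff ℝ ∞ fun x => lap u (r • x) := hu.lap.comp hs
    have hconst := lap_mul (f := fun _ => r ^ 2) contDiff_const hv x
    rw [hlap, hconst, lap_comp_smul hu.lap, hu0]
    simp [lap, coordDeriv]
  have hscale (w : EuclideanSpace ℝ (Fin n) → ℝ) (ρ : ℝ) (hρ : 0 ≤ ρ) :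
      ∫ x in Metric.ball (0 : EuclideanSpace ℝ (Fin n)) ρ, w (r • x) ^ 2 =
        (r ^ n)⁻¹ * ∫ x in Metric.ball (0 : EuclideanSpace ℝ (Fin n)) (ρ * r), w x ^ 2 := by
    rw [Measure.setIntegral_comp_smul_of_pos volume (fun x => w x ^ 2) _ hr0, smul_ball hr0.ne']
    simp [abs_of_pos hr0, mul_comm]
  simp only [hlap, mul_pow, integral_const_mul] at h
  rw [hscale _ _ zero_le_one, hscale _ _ (by linarith), one_mul] at h
  have hrn : 0 < (r ^ n)⁻¹ := by positivity
  have h' : (r ^ 2) ^ 2 * ∫ x in Metric.ball (0 : EuclideanSpace ℝ (Fin n)) r, (lap u x) ^ 2 ≤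
      C * ∫ x in Metric.ball (0 : EuclideanSpace ℝ (Fin n)) (α * r), (u x) ^ 2 := by
    refine le_of_mul_le_mul_left ?_ hrn
    linarith
  refine le_trans (mul_le_mul_of_nonneg_right ?_ (integral_nonneg fun x => sq_nonneg _)) h'
  nlinarith [one_lt_pow₀ hr two_ne_zero]
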